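/- Suppose f : ℝ → ℝ solves the safe-integration equation for (g₀, h₀, h₁). Then for every n ∈ ℕ, f(2n+2) = h₀(n+1, f(n+1)). -/

import Mathlib

noncomputable def parity (x : ℝ) : ℝ := max 0 (Real.pi / 2 * Real.sin (Real.pi * x))

noncomputable def pfun (x : ℝ) : ℝ := ∫ t in (0:ℝ)..(x - 1), parity t

noncomputable def pfun' (x : ℝ) : ℝ := pfun (x - 1) + 1

def SolvesSafeIntegration (g0 : ℝ) (h0 h1 : ℝ → ℝ → ℝ) (f : ℝ → ℝ) : Prop :=
  f 0 = g0 ∧ ∀ x : ℝ, HasDerivAt f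
    (parity x * (h1 (pfun x) (f (pfun x)) - f (2 * pfun x)) +
     parity (x - 1) * (h0 (pfun' x) (f (pfun' x)) - f (2 * pfun' x - 1))) x

open Real in
lemma parity_periodic : Function.Periodic parity 2 := by
  intro x
  simp only [parity]
  rw [show π * (x + 2) = π * x + 2 * π by ring, sin_add_two_pi]

lemma parity_add_two_mul_nat (x : ℝ) (n : ℕ) : parity (x + 2 * n) = parity x := by
  rw [mul_comm]
  exact parity_periodic.nat_mul n x

lemma continuous_parity : Continuous parity := by
  unfold parity
  fun_prop

open Real in
lemma parity_eq_of_mem_Icc {x : ℝ} (hx : x ∈ Set.Icc (0 : ℝ) 1) :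
    parity x = π / 2 * sin (π * x) := by
  have hs : 0 ≤ sin (π * x) :=
    sin_nonneg_of_nonneg_of_le_pi (mul_nonneg pi_pos.le hx.1) (by nlinarith [pi_pos, hx.2])
  exact max_eq_right (by positivity)

open Real in
lemma parity_eq_zero_of_mem_Icc {x : ℝ} (hx : x ∈ Set.Icc (-1 : ℝ) 0) : parity x = 0 := by
  have hs : sin (π * x) ≤ 0 :=
    sin_nonpos_of_nonpos_of_neg_pi_le (by nlinarith [pi_pos, hx.2]) (by nlinarith [pi_pos, hx.1])
  exact max_eq_left (mul_nonpos_of_nonneg_of_nonpos (by positivity) hs)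

open Real in
lemma integral_parity_zero_one : ∫ t in (0 : ℝ)..1, parity t = 1 := by
  have h : ∫ t in (0 : ℝ)..1, parity t = ∫ t in (0 : ℝ)..1, π / 2 * sin (π * t) :=
    intervalIntegral.integral_congr fun t ht => parity_eq_of_mem_Icc (by simpa using ht)
  rw [h, intervalIntegral.integral_const_mul,
    intervalIntegral.integral_comp_mul_left _ pi_ne_zero, integral_sin]
  simp
  field_simp
  norm_num

lemma integral_parity_eq_zero {a b : ℝ} (ha : a ∈ Set.Icc (-1 : ℝ) 0)
    (hb : b ∈ Set.Icc (-1 : ℝ) 0) : ∫ t in a..b, parity t = 0 := by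
  have h : ∫ t in a..b, parity t = ∫ _ in a..b, (0 : ℝ) :=
    intervalIntegral.integral_congr fun t ht =>
      parity_eq_zero_of_mem_Icc (Set.uIcc_subset_Icc ha hb ht)
  simpa using h

lemma integral_parity_neg_one_one : ∫ t in (-1 : ℝ)..1, parity t = 1 := by
  rw [← intervalIntegral.integral_add_adjacent_intervals
      (continuous_parity.intervalIntegrable (-1) 0) (continuous_parity.intervalIntegrable 0 1),
    integral_parity_eq_zero (by norm_num) (by norm_num), integral_parity_zero_one, zero_add]

lemma pfun_add_two (x : ℝ) : pfun (x + 2) = pfun x + 1 := by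
  unfold pfun
  have h := parity_periodic.intervalIntegral_add_eq (x - 1) (-1)
  rw [show (-1 : ℝ) + 2 = 1 by norm_num, integral_parity_neg_one_one,
    show x - 1 + 2 = x + 2 - 1 by ring] at h
  rw [← intervalIntegral.integral_add_adjacent_intervals
    (continuous_parity.intervalIntegrable 0 (x - 1))
    (continuous_parity.intervalIntegrable (x - 1) (x + 2 - 1)), h]

lemma pfun_add_two_mul_nat {x : ℝ} (hx : x ∈ Set.Icc (0 : ℝ) 1) (n : ℕ) :
    pfun (x + 2 * n) = n := by
  induction n with
  | zero =>
    simpa [pfun] using integral_parity_eq_zero (a := 0) (b := x - 1) (by norm_num)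
      ⟨by linarith [hx.1], by linarith [hx.2]⟩
  | succ n ih =>
    push_cast
    rw [show x + 2 * ((n : ℝ) + 1) = x + 2 * n + 2 by ring, pfun_add_two, ih]

theorem safe_integration_even_value (g0 : ℝ) (h0 h1 : ℝ → ℝ → ℝ) (f : ℝ → ℝ)
    (hf : SolvesSafeIntegration g0 h0 h1 f) :
    ∀ n : ℕ, f (2*n + 2) = h0 (n + 1) (f (n + 1)) := by
  intro n
  set c : ℝ := h0 (n + 1) (f (n + 1)) - f (2 * n + 1) with hc
  have hderiv : ∀ t ∈ Set.uIcc (0 : ℝ) 1,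
      HasDerivAt (fun s => f (s + (2 * n + 1))) (parity t * c) t := by
    intro t ht
    rw [Set.uIcc_of_le zero_le_one] at ht
    have hodd : parity (t + (2 * n + 1)) = 0 := by
      rw [show t + (2 * (n : ℝ) + 1) = (t - 1) + 2 * ((n + 1 : ℕ) : ℝ) by push_cast; ring,
        parity_add_two_mul_nat]
      exact parity_eq_zero_of_mem_Icc ⟨by linarith [ht.1], by linarith [ht.2]⟩
    have hsub : t + (2 * (n : ℝ) + 1) - 1 = t + 2 * n := by ring
    have hp : pfun' (t + (2 * n + 1)) = n + 1 := by
      rw [pfun', hsub, pfun_add_two_mul_nat ht]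
    have h := hf.2 (t + (2 * n + 1))
    rw [hodd, hp, hsub, parity_add_two_mul_nat, zero_mul, zero_add,
      show 2 * ((n : ℝ) + 1) - 1 = 2 * n + 1 by ring] at h
    exact h.comp_add_const t (2 * n + 1)
  have hint := intervalIntegral.integral_eq_sub_of_hasDerivAt hderiv
    ((continuous_parity.mul continuous_const).intervalIntegrable 0 1)
  rw [intervalIntegral.integral_mul_const, integral_parity_zero_one, one_mul, zero_add,
    show (1 : ℝ) + (2 * n + 1) = 2 * n + 2 by ring] at hint
  linarith
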